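/- arXiv:1410.5086 — 2 statements merged into one kernel-verified Lean document; each statement's English description precedes it below -/
import Mathlib

section
/- Let Y ⊆ Σ^ℕ be a topologically transitive subshift of finite type, φ: Y → ℝ a Hölder function, and μ a shift-invariant probability measure on Y with the Gibbs property for φ. Then there is a constant K > 0 such that for all finite words u, v, c over Σ with [uvc] ∩ Y ≠ ∅: | μ([uvc])/μ([uv]) − μ([vc])/μ([v]) | ≤ K ρ^{|v|}. (That is, the conditional probabilities of a cylinder given a finite past depend on the remote past only up to an error exponentially small in the length of the recent past.) -/
open MeasureTheory Filter Topology

/-- The one-sided shift on sequences. -/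
def shiftN {A : Type*} (ω : ℕ → A) : ℕ → A := fun k => ω (k + 1)

/-- The concatenation `aω` of a finite word `a` with an infinite sequence `ω`. -/
def prepend {A : Type*} (a : List A) (ω : ℕ → A) : ℕ → A :=
  fun i => if h : i < a.length then a.get ⟨i, h⟩ else ω (i - a.length)

/-- The cylinder set `[a]` of sequences having the word `a` as a prefix. -/
def cylinder {A : Type*} (a : List A) : Set (ℕ → A) :=
  {ω | ∀ i : Fin a.length, ω i = a.get i}

/-- The Birkhoff sum `S_j^φ(ω) = ∑_{i=0}^{j-1} φ(T^i ω)`. -/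
def birkhoff {A : Type*} (φ : (ℕ → A) → ℝ) (j : ℕ) (ω : ℕ → A) : ℝ :=
  ∑ i ∈ Finset.range j, φ (shiftN^[i] ω)

/-- The subshift of finite type determined by a transition relation `M`. -/
def SFT {A : Type*} (M : A → A → Prop) : Set (ℕ → A) :=
  {ω | ∀ k : ℕ, M (ω k) (ω (k + 1))}

/-- Irreducibility of the transition relation `M` (equivalently, topological
transitivity of the subshift of finite type): any symbol can be joined to any
other by an admissible path of length `k ≥ 1`. -/
def IrreducibleTransition {A : Type*} (M : A → A → Prop) : Prop :=
  ∀ a b : A, ∃ k ≥ 1, ∃ p : ℕ → A, p 0 = a ∧ p k = b ∧ ∀ i < k, M (p i) (p (i + 1))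

/-- `φ` is Hölder on `Y` for the metric `d(ω,ω̃) = ρ^(min{k : ω_k ≠ ω̃_k})`:
if `ω, ω̃ ∈ Y` agree in their first `N` coordinates then `|φ ω - φ ω̃| ≤ K ρ^N`. -/
def IsHolder {A : Type*} (Y : Set (ℕ → A)) (φ : (ℕ → A) → ℝ) (ρ : ℝ) : Prop :=
  ∃ K > 0, ∀ ω ∈ Y, ∀ ω' ∈ Y, ∀ N : ℕ,
    (∀ i < N, ω i = ω' i) → |φ ω - φ ω'| ≤ K * ρ ^ N

/-- `μ` has the Gibbs property on `Y` for the potential `φ` and pressure `P`: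
`K⁻¹ ≤ μ([a]) / exp(-|a| P + S_{|a|}^φ(aω)) ≤ K` for every word `a` and
every `ω` with `aω ∈ Y`. -/
def HasGibbsProperty {A : Type*} [MeasurableSpace A]
    (Y : Set (ℕ → A)) (μ : MeasureTheory.Measure (ℕ → A)) (φ : (ℕ → A) → ℝ) (P : ℝ) : Prop :=
  ∃ K > 0, ∀ (a : List A) (ω : ℕ → A), prepend a ω ∈ Y →
    K⁻¹ * Real.exp (-(a.length : ℝ) * P + birkhoff φ a.length (prepend a ω)) ≤
        (μ (cylinder a)).toReal ∧
      (μ (cylinder a)).toReal ≤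
        K * Real.exp (-(a.length : ℝ) * P + birkhoff φ a.length (prepend a ω))

/-- The operator sending a function `F` on words to `w ↦ ∑ a, F (wa)`. -/
def extensionSum (A : Type*) [Fintype A] : Module.End ℝ (List A → ℝ) where
  toFun F w := ∑ a, F (w ++ [a])
  map_add' F G := by ext w; simp [Finset.sum_add_distrib]
  map_smul' r F := by ext w; simp [Finset.mul_sum]

section ExtensionSum

variable {A : Type*} [Fintype A]

lemma extensionSum_apply (F : List A → ℝ) (w : List A) :
    extensionSum A F w = ∑ a, F (w ++ [a]) := rfl

lemma extensionSum_pow_succ_apply (m : ℕ) (F : List A → ℝ) (w : List A) :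
    (extensionSum A ^ (m + 1)) F w = ∑ a, (extensionSum A ^ m) F (w ++ [a]) := by
  rw [pow_succ', Module.End.mul_apply, extensionSum_apply]

lemma extensionSum_pow_mono (m : ℕ) {F G : List A → ℝ} (p : List A)
    (h : ∀ y, F (p ++ y) ≤ G (p ++ y)) :
    (extensionSum A ^ m) F p ≤ (extensionSum A ^ m) G p := by
  induction m generalizing p with
  | zero => simpa using h []
  | succ m ih =>
    simp only [extensionSum_pow_succ_apply]
    refine Finset.sum_le_sum fun a _ => ih _ fun y => ?_
    simpa using h (a :: y)

lemma extensionSum_pow_prefix (m : ℕ) (F : List A → ℝ) (p w : List A) :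
    (extensionSum A ^ m) (fun x => F (p ++ x)) w = (extensionSum A ^ m) F (p ++ w) := by
  induction m generalizing w with
  | zero => simp
  | succ m ih => simp only [extensionSum_pow_succ_apply, ih, List.append_assoc]

lemma extensionSum_pow_fixed (m : ℕ) {F : List A → ℝ} (h : extensionSum A F = F) :
    (extensionSum A ^ m) F = F := by
  induction m with
  | zero => simp
  | succ m ih => rw [pow_succ, Module.End.mul_apply, h, ih]

lemma extensionSum_pow_nonneg (m : ℕ) {F : List A → ℝ} (h : ∀ x, 0 ≤ F x) (w : List A) :
    0 ≤ (extensionSum A ^ m) F w := by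
  have := extensionSum_pow_mono m (F := 0) (G := F) w (fun y => h _)
  simpa using this

lemma apply_append_le_extensionSum_pow {F : List A → ℝ} (h : ∀ x, 0 ≤ F x) (w v : List A) :
    F (w ++ v) ≤ (extensionSum A ^ v.length) F w := by
  induction v generalizing w with
  | nil => simp
  | cons a v ih =>
    rw [List.length_cons, extensionSum_pow_succ_apply]
    calc F (w ++ a :: v) ≤ (extensionSum A ^ v.length) F (w ++ [a]) := by simpa using ih (w ++ [a])
      _ ≤ _ := Finset.single_le_sum (f := fun a => (extensionSum A ^ v.length) F (w ++ [a]))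
          (fun b _ => extensionSum_pow_nonneg _ h _) (Finset.mem_univ a)

lemma extensionSum_pow_cauchySchwarz (m : ℕ) {X e n : List A → ℝ} (he : ∀ x, 0 ≤ e x)
    (hn : ∀ x, 0 ≤ n x) (h : ∀ x, X x ^ 2 ≤ e x * n x) (w : List A) :
    (extensionSum A ^ m) X w ^ 2 ≤ (extensionSum A ^ m) e w * (extensionSum A ^ m) n w := by
  induction m generalizing w with
  | zero => simpa using h w
  | succ m ih =>
    simp only [extensionSum_pow_succ_apply]
    exact Finset.sum_sq_le_sum_mul_sum_of_sq_le_mul _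
      (fun a _ => extensionSum_pow_nonneg m he _) (fun a _ => extensionSum_pow_nonneg m hn _)
      (fun a _ => ih _)

/-- A left-invariant function on words is the sum of its values over all left extensions of a
given length. -/
lemma extensionSum_pow_append_nil {F : List A → ℝ} (hF : ∀ v, ∑ a, F (a :: v) = F v)
    (m : ℕ) (v : List A) : (extensionSum A ^ m) (fun w => F (w ++ v)) [] = F v := by
  induction m generalizing v with
  | zero => simp
  | succ m ih =>
    have : extensionSum A (fun w => F (w ++ v)) = ∑ a, fun w => F (w ++ a :: v) := by
      ext w
      simp [extensionSum_apply]
    rw [pow_succ, Module.End.mul_apply, this, map_sum, Finset.sum_apply]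
    simp only [ih, hF]

/-- A function on words comparable to an additive one can be replaced by an additive one (a Banach
limit of its extension sums) that inherits all its multiplicative inequalities. -/
lemma exists_additive_of_comparable {Z F : List A → ℝ} {K : ℝ} (hF : extensionSum A F = F)
    (hZ0 : ∀ x, 0 ≤ Z x) (hZF : ∀ x, Z x ≤ K * F x) (hFZ : ∀ x, F x ≤ K * Z x) :
    ∃ G : List A → ℝ, extensionSum A G = G ∧ (∀ x, 0 ≤ G x) ∧ (∀ x, G x ≤ K * F x) ∧
      (∀ x, F x ≤ K * G x) ∧
      ∀ (p q : List A) (Q R : ℝ), (∀ y, Q * Z (p ++ y) ≤ R * Z (q ++ y)) → Q * G p ≤ R * G q := by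
  set f : List A → ℕ → ℝ := fun v k => (extensionSum A ^ k) Z v with hf
  set c : List A → ℕ → ℝ := fun v N => (N : ℝ)⁻¹ * ∑ k ∈ Finset.range N, f v k with hc
  have hf0 : ∀ v k, 0 ≤ f v k := fun v k => extensionSum_pow_nonneg k hZ0 v
  have hfK : ∀ v k, f v k ≤ K * F v := fun v k => by
    have := extensionSum_pow_mono k (F := Z) (G := K • F) v (fun y => hZF _)
    rwa [map_smul, extensionSum_pow_fixed k hF] at this
  have hfF : ∀ v k, F v ≤ K * f v k := fun v k => by
    have := extensionSum_pow_mono k (F := F) (G := K • Z) v (fun y => hFZ _)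
    rwa [map_smul, extensionSum_pow_fixed k hF] at this
  have hfPQ : ∀ (p q : List A) (Q R : ℝ), (∀ y, Q * Z (p ++ y) ≤ R * Z (q ++ y)) →
      ∀ k, Q * f p k ≤ R * f q k := fun p q Q R h k => by
    have := extensionSum_pow_mono k (F := Q • fun x => Z (p ++ x)) (G := R • fun x => Z (q ++ x)) []
      (fun y => by simpa using h y)
    simpa [map_smul, extensionSum_pow_prefix] using this
  have hKF : ∀ v, 0 ≤ K * F v := fun v => (hZ0 v).trans (hZF v)
  have hconst : ∀ (N : ℕ) (r : ℝ), N ≠ 0 → (N : ℝ)⁻¹ * ∑ _k ∈ Finset.range N, r = r := by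
    intro N r hN
    have : (N : ℝ) ≠ 0 := by exact_mod_cast hN
    simp [this]
  have hc0 : ∀ v N, 0 ≤ c v N := fun v N =>
    mul_nonneg (by positivity) (Finset.sum_nonneg fun k _ => hf0 v k)
  have hcK : ∀ v N, c v N ≤ K * F v := fun v N => by
    rcases eq_or_ne N 0 with rfl | hN
    · simpa [hc] using hKF v
    · rw [← hconst N (K * F v) hN]
      exact mul_le_mul_of_nonneg_left (Finset.sum_le_sum fun k _ => hfK v k) (by positivity)
  let U : Ultrafilter ℕ := hyperfilter ℕ
  have hU : (U : Filter ℕ) ≤ atTop := by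
    rw [← Nat.cofinite_eq_atTop]; exact hyperfilter_le_cofinite
  have hlim : ∀ v, ∃ x, Tendsto (c v) U (𝓝 x) := fun v => by
    obtain ⟨x, -, hx⟩ := (isCompact_Icc (a := 0) (b := K * F v)).ultrafilter_le_nhds (U.map (c v))
      (by
        rw [Ultrafilter.coe_map, le_principal_iff, mem_map]
        exact univ_mem' fun N => ⟨hc0 v N, hcK v N⟩)
    exact ⟨x, hx⟩
  choose G hG using hlim
  refine ⟨G, ?_, fun x => ge_of_tendsto' (hG x) (hc0 x), fun x => le_of_tendsto' (hG x) (hcK x),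
    fun x => ?_, fun p q Q R h => ?_⟩
  · ext v
    rw [extensionSum_apply]
    have h1 : Tendsto (fun N => ∑ a, c (v ++ [a]) N) U (𝓝 (∑ a, G (v ++ [a]))) :=
      tendsto_finsetSum _ fun a _ => hG _
    have h2 : ∀ N, ∑ a, c (v ++ [a]) N = c v N + (N : ℝ)⁻¹ * (f v N - f v 0) := fun N => by
      simp only [hc, ← Finset.mul_sum, ← mul_add]
      rw [Finset.sum_comm, ← Finset.sum_range_sub, ← Finset.sum_add_distrib]
      congr 1
      refine Finset.sum_congr rfl fun k _ => ?_
      simp only [hf, extensionSum_pow_succ_apply]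
      ring
    have h3 : Tendsto (fun N : ℕ => (N : ℝ)⁻¹ * (f v N - f v 0)) atTop (𝓝 0) := by
      refine bdd_le_mul_tendsto_zero' (2 * (K * F v)) ?_ tendsto_inv_atTop_nhds_zero_nat |>.congr
        fun N => mul_comm _ _
      refine Eventually.of_forall fun N => abs_le.2 ⟨?_, ?_⟩ <;>
        linarith [hf0 v N, hf0 v 0, hfK v N, hfK v 0]
    have h4 := (hG v).add (h3.mono_left hU)
    rw [add_zero] at h4
    exact tendsto_nhds_unique h1 (h4.congr fun N => (h2 N).symm)
  · refine ge_of_tendsto ((hG x).const_mul K) (hU ((eventually_ne_atTop 0).mono fun N hN => ?_))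
    rw [← hconst N (F x) hN, mul_left_comm, Finset.mul_sum (a := K)]
    exact mul_le_mul_of_nonneg_left (Finset.sum_le_sum fun k _ => hfF x k)
      (inv_nonneg.2 N.cast_nonneg)
  · refine le_of_tendsto_of_tendsto' ((hG p).const_mul Q) ((hG q).const_mul R) fun N => ?_
    simp only [hc]
    rw [mul_left_comm Q, mul_left_comm R, Finset.mul_sum (a := Q), Finset.mul_sum (a := R)]
    exact mul_le_mul_of_nonneg_left (Finset.sum_le_sum fun k _ => hfPQ p q Q R h k)
      (inv_nonneg.2 N.cast_nonneg)

/-- If `F` and `G` are comparable additive functions on words and `F` is left-invariant, then `F v`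
is recovered from `G` and the ratios `F w / G w` on long words `w`. -/
lemma tendsto_extensionSum_ratio {F G : List A → ℝ} {K : ℝ} (hF : extensionSum A F = F)
    (hG : extensionSum A G = G) (hF0 : ∀ x, 0 ≤ F x) (hG0 : ∀ x, 0 ≤ G x)
    (hGF : ∀ x, G x ≤ K * F x) (hFG : ∀ x, F x ≤ K * G x)
    (hinv : ∀ v, ∑ a, F (a :: v) = F v) (v : List A) :
    Tendsto (fun m => (extensionSum A ^ m) (fun w => F w / G w * G (w ++ v)) []) atTop
      (𝓝 (F v)) := by
  have hzero : ∀ x, G x = 0 → F x = 0 := fun x h => le_antisymm (by simpa [h] using hFG x) (hF0 x)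
  set H : List A → ℝ := fun x => F x ^ 2 / G x with hH
  have hsq : ∀ (b : ℝ) (l : ℕ) (w : List A),
      (extensionSum A ^ l) (fun x => (F x - b * G x) ^ 2 / G x) w =
        (extensionSum A ^ l) H w - 2 * b * F w + b ^ 2 * G w := by
    intro b l w
    have : (fun x => (F x - b * G x) ^ 2 / G x) = H - (2 * b) • F + b ^ 2 • G := by
      ext x
      simp only [hH, Pi.add_apply, Pi.sub_apply, Pi.smul_apply, smul_eq_mul]
      rcases eq_or_ne (G x) 0 with h | h
      · simp [h, hzero x h]
      · field_simp
        ring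
    rw [this, map_add, map_sub, map_smul, map_smul, extensionSum_pow_fixed l hF,
      extensionSum_pow_fixed l hG]
    simp
  have hsq' : ∀ (l : ℕ) (w : List A),
      (extensionSum A ^ l) (fun x => (F x - F w / G w * G x) ^ 2 / G x) w =
        (extensionSum A ^ l) H w - H w := by
    intro l w
    rw [hsq]
    rcases eq_or_ne (G w) 0 with h | h
    · simp [hH, h]
    · simp only [hH]
      field_simp
      ring
  have hterm : ∀ b x, 0 ≤ (F x - b * G x) ^ 2 / G x := fun b x => div_nonneg (sq_nonneg _) (hG0 x)
  have hinc : ∀ (l : ℕ) (w : List A), 0 ≤ (extensionSum A ^ l) H w - H w := fun l w => by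
    rw [← hsq']
    exact extensionSum_pow_nonneg l (hterm _) w
  have hHF : ∀ x, H x ≤ K * F x := fun x => by
    rcases (hG0 x).eq_or_lt with h | h
    · simp [hH, ← h, hzero x h.symm]
    · rw [hH]
      simp only
      rw [div_le_iff₀ h]
      nlinarith [mul_le_mul_of_nonneg_left (hFG x) (hF0 x)]
  have hmono : Monotone fun m => (extensionSum A ^ m) H [] := monotone_nat_of_le_succ fun m => by
    rw [pow_succ, Module.End.mul_apply]
    refine extensionSum_pow_mono m [] fun y => ?_
    simpa using hinc 1 y
  have hbdd : BddAbove (Set.range fun m => (extensionSum A ^ m) H []) := by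
    refine ⟨K * F [], ?_⟩
    rintro _ ⟨m, rfl⟩
    have := extensionSum_pow_mono m (F := H) (G := K • F) [] (fun y => hHF _)
    rwa [map_smul, extensionSum_pow_fixed m hF] at this
  have hlim := tendsto_atTop_ciSup hmono hbdd
  have hdiff : Tendsto (fun m => ((extensionSum A ^ (m + v.length)) H [] -
      (extensionSum A ^ m) H []) * (K * F v)) atTop (𝓝 0) := by
    have := (((tendsto_add_atTop_iff_nat v.length).2 hlim).sub hlim).mul_const (K * F v)
    simpa using this
  have hbound : ∀ m, ((extensionSum A ^ m) (fun w => F w / G w * G (w ++ v)) [] - F v) ^ 2 ≤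
      ((extensionSum A ^ (m + v.length)) H [] - (extensionSum A ^ m) H []) * (K * F v) := by
    intro m
    have h1 := extensionSum_pow_cauchySchwarz m
      (X := (fun w => F w / G w * G (w ++ v)) - fun w => F (w ++ v))
      (e := (extensionSum A ^ v.length) H - H) (n := fun w => G (w ++ v))
      (hinc v.length) (fun w => hG0 _) (fun w => ?_) []
    · rw [map_sub, map_sub, Pi.sub_apply, Pi.sub_apply, extensionSum_pow_append_nil hinv,
        ← Module.End.mul_apply, ← pow_add] at h1
      refine h1.trans (mul_le_mul_of_nonneg_left ?_ (sub_nonneg.2 (hmono (Nat.le_add_right _ _))))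
      have := extensionSum_pow_mono m (F := fun w => G (w ++ v)) (G := K • fun w => F (w ++ v)) []
        (fun y => hGF _)
      rwa [map_smul, Pi.smul_apply, extensionSum_pow_append_nil hinv] at this
    · have h2 := apply_append_le_extensionSum_pow (hterm (F w / G w)) w v
      rw [hsq'] at h2
      simp only [Pi.sub_apply]
      rcases (hG0 (w ++ v)).eq_or_lt with h | h
      · simp [← h, hzero _ h.symm]
      · rw [div_le_iff₀ h] at h2
        linarith [sub_sq_comm (F w / G w * G (w ++ v)) (F (w ++ v))]
  have h0 : Tendsto (fun m => ((extensionSum A ^ m) (fun w => F w / G w * G (w ++ v)) [] - F v) ^ 2)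
      atTop (𝓝 0) := squeeze_zero (fun m => sq_nonneg _) hbound hdiff
  have h1 := (Real.continuous_sqrt.tendsto 0).comp h0
  simp only [Function.comp_def, Real.sqrt_sq_eq_abs, Real.sqrt_zero] at h1
  exact tendsto_sub_nhds_zero_iff.1 ((tendsto_zero_iff_abs_tendsto_zero _).2 h1)

/-- Two words `v`, `v'` whose `G`-ratio is almost unaffected by left extensions have almost the
same ratio for `F`. -/
lemma mul_le_mul_of_forall_left_extension {F G : List A → ℝ} {K : ℝ} (hF : extensionSum A F = F)
    (hG : extensionSum A G = G) (hF0 : ∀ x, 0 ≤ F x) (hG0 : ∀ x, 0 ≤ G x)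
    (hGF : ∀ x, G x ≤ K * F x) (hFG : ∀ x, F x ≤ K * G x)
    (hinv : ∀ v, ∑ a, F (a :: v) = F v) {v v' : List A} {r s : ℝ}
    (h : ∀ w, r * G (w ++ v) ≤ s * G (w ++ v')) : r * F v ≤ s * F v' := by
  have hlim := tendsto_extensionSum_ratio hF hG hF0 hG0 hGF hFG hinv
  refine le_of_tendsto_of_tendsto' ((hlim v).const_mul r) ((hlim v').const_mul s) fun m => ?_
  have := extensionSum_pow_mono m (F := r • fun w => F w / G w * G (w ++ v))
    (G := s • fun w => F w / G w * G (w ++ v')) [] fun y => by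
      simp only [Pi.smul_apply, smul_eq_mul, List.nil_append, mul_left_comm _ (F y / G y)]
      exact mul_le_mul_of_nonneg_left (h y) (div_nonneg (hF0 y) (hG0 y))
  rwa [map_smul, map_smul] at this

end ExtensionSum

section Cylinder

variable {A : Type*}

lemma shiftN_iterate_apply (n : ℕ) (ω : ℕ → A) (k : ℕ) : shiftN^[n] ω k = ω (k + n) := by
  induction n generalizing ω with
  | zero => rfl
  | succ n ih => rw [Function.iterate_succ_apply, ih, shiftN, add_assoc]

lemma mem_cylinder_iff {a : List A} {ω : ℕ → A} :
    ω ∈ cylinder a ↔ ∀ (i : ℕ) (h : i < a.length), ω i = a[i] :=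
  ⟨fun h i hi => h ⟨i, hi⟩, fun h i => h i i.2⟩

lemma mem_cylinder_nil (ω : ℕ → A) : ω ∈ cylinder ([] : List A) := fun i => i.elim0

lemma mem_cylinder_append {p q : List A} {ω : ℕ → A} :
    ω ∈ cylinder (p ++ q) ↔ ω ∈ cylinder p ∧ shiftN^[p.length] ω ∈ cylinder q := by
  simp only [mem_cylinder_iff, shiftN_iterate_apply]
  constructor
  · refine fun h => ⟨fun i hi => ?_, fun i hi => ?_⟩
    · rw [h i (by simp; omega), List.getElem_append_left hi]
    · rw [h (i + p.length) (by simp; omega), List.getElem_append_right (by omega)]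
      simp
  · rintro ⟨h1, h2⟩ i hi
    rcases lt_or_ge i p.length with h | h
    · rw [h1 i h, List.getElem_append_left h]
    · rw [List.getElem_append_right h, ← h2 (i - p.length) (by simp at hi; omega)]
      congr 1
      omega

lemma mem_cylinder_singleton {a : A} {ω : ℕ → A} : ω ∈ cylinder [a] ↔ ω 0 = a := by
  simp [mem_cylinder_iff]

lemma mem_cylinder_cons {a : A} {q : List A} {ω : ℕ → A} :
    ω ∈ cylinder (a :: q) ↔ ω 0 = a ∧ shiftN ω ∈ cylinder q := by
  rw [← List.singleton_append, mem_cylinder_append, mem_cylinder_singleton]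
  rfl

lemma shiftN_iterate_prepend (a : List A) (ω : ℕ → A) : shiftN^[a.length] (prepend a ω) = ω := by
  ext k
  simp [shiftN_iterate_apply, prepend]

lemma prepend_mem_cylinder (a : List A) (ω : ℕ → A) : prepend a ω ∈ cylinder a := by
  rw [mem_cylinder_iff]
  intro i hi
  simp [prepend, hi]

lemma prepend_shiftN_iterate {a : List A} {ω : ℕ → A} (h : ω ∈ cylinder a) :
    prepend a (shiftN^[a.length] ω) = ω := by
  rw [mem_cylinder_iff] at h
  ext k
  rcases lt_or_ge k a.length with hk | hk
  · simp [prepend, hk, h k hk]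
  · simp [prepend, hk.not_gt, shiftN_iterate_apply, hk]

lemma iUnion_cylinder_append_singleton (w : List A) : ⋃ a, cylinder (w ++ [a]) = cylinder w := by
  ext ω
  simp [mem_cylinder_append, mem_cylinder_singleton]

lemma iUnion_cylinder_cons (v : List A) : ⋃ a, cylinder (a :: v) = shiftN ⁻¹' cylinder v := by
  ext ω
  simp [mem_cylinder_cons]

lemma cylinder_append_subset (p q : List A) : cylinder (p ++ q) ⊆ cylinder p :=
  fun _ h => (mem_cylinder_append.1 h).1

lemma shiftN_iterate_mem_SFT {M : A → A → Prop} {ω : ℕ → A} (h : ω ∈ SFT M) (n : ℕ) :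
    shiftN^[n] ω ∈ SFT M := fun k => by
  simpa only [shiftN_iterate_apply, Nat.add_right_comm] using h (k + n)

lemma eq_of_mem_cylinder {a : List A} {ω ω' : ℕ → A} (h : ω ∈ cylinder a) (h' : ω' ∈ cylinder a)
    {i : ℕ} (hi : i < a.length) : ω i = ω' i := (h ⟨i, hi⟩).trans (h' ⟨i, hi⟩).symm

/-- The Markov property: points of an SFT sharing a nonempty word can be spliced along it. -/
lemma prepend_mem_SFT {M : A → A → Prop} {w v : List A} (hv : v ≠ []) {ω₀ ω : ℕ → A}
    (hω₀ : ω₀ ∈ cylinder (w ++ v) ∩ SFT M) (hω : ω ∈ cylinder v ∩ SFT M) :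
    prepend w ω ∈ SFT M := by
  obtain ⟨h0, hY0⟩ := hω₀
  have hv' : 0 < v.length := List.length_pos_of_ne_nil hv
  have hmem : prepend w ω ∈ cylinder (w ++ v) :=
    mem_cylinder_append.2 ⟨prepend_mem_cylinder _ _, by rw [shiftN_iterate_prepend]; exact hω.1⟩
  intro k
  rcases lt_or_ge k w.length with hk | hk
  · have hl : (w ++ v).length = w.length + v.length := List.length_append
    rw [eq_of_mem_cylinder hmem h0 (i := k) (by omega),
      eq_of_mem_cylinder hmem h0 (i := k + 1) (by omega)]
    exact hY0 k
  · have h1 : ¬ k + 1 < w.length := by omega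
    have h2 : k + 1 - w.length = k - w.length + 1 := by omega
    simpa [prepend, hk.not_gt, h1, h2] using hω.2 (k - w.length)

lemma birkhoff_add (φ : (ℕ → A) → ℝ) (m n : ℕ) (ω : ℕ → A) :
    birkhoff φ (m + n) ω = birkhoff φ m ω + birkhoff φ n (shiftN^[m] ω) := by
  simp only [birkhoff, Finset.sum_range_add, ← Function.iterate_add_apply, add_comm]

/-- Bounded distortion of Birkhoff sums of a Hölder function. -/
lemma abs_birkhoff_sub_le {M : A → A → Prop} {φ : (ℕ → A) → ℝ} {ρ K : ℝ} (hρ0 : 0 ≤ ρ)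
    (hρ1 : ρ < 1) (hK : 0 ≤ K)
    (hφ : ∀ ω ∈ SFT M, ∀ ω' ∈ SFT M, ∀ N : ℕ, (∀ i < N, ω i = ω' i) → |φ ω - φ ω'| ≤ K * ρ ^ N)
    (m n : ℕ) {ω ω' : ℕ → A} (hω : ω ∈ SFT M) (hω' : ω' ∈ SFT M)
    (h : ∀ i < m + n, ω i = ω' i) :
    |birkhoff φ m ω - birkhoff φ m ω'| ≤ K / (1 - ρ) * ρ ^ n := by
  have hgeom : ∑ j ∈ Finset.range m, ρ ^ (j + 1) ≤ (1 - ρ)⁻¹ := by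
    calc ∑ j ∈ Finset.range m, ρ ^ (j + 1) ≤ ∑ j ∈ Finset.range m, ρ ^ j :=
          Finset.sum_le_sum fun j _ => pow_le_pow_of_le_one hρ0 hρ1.le j.le_succ
      _ ≤ ∑' j, ρ ^ j := (summable_geometric_of_lt_one hρ0 hρ1).sum_le_tsum _
          fun j _ => pow_nonneg hρ0 j
      _ = _ := tsum_geometric_of_lt_one hρ0 hρ1
  calc |birkhoff φ m ω - birkhoff φ m ω'|
      = |∑ i ∈ Finset.range m, (φ (shiftN^[i] ω) - φ (shiftN^[i] ω'))| := by
        simp only [birkhoff, Finset.sum_sub_distrib]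
    _ ≤ ∑ i ∈ Finset.range m, |φ (shiftN^[i] ω) - φ (shiftN^[i] ω')| :=
        Finset.abs_sum_le_sum_abs _ _
    _ ≤ ∑ i ∈ Finset.range m, K * ρ ^ n * ρ ^ (m - 1 - i + 1) := by
        refine Finset.sum_le_sum fun i hi => ?_
        rw [Finset.mem_range] at hi
        rw [mul_assoc, ← pow_add]
        refine hφ _ (shiftN_iterate_mem_SFT hω i) _ (shiftN_iterate_mem_SFT hω' i) _ fun j hj => ?_
        simp only [shiftN_iterate_apply]
        exact h _ (by omega)
    _ = K * ρ ^ n * ∑ j ∈ Finset.range m, ρ ^ (j + 1) := by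
        rw [← Finset.mul_sum, Finset.sum_range_reflect (fun j => ρ ^ (j + 1))]
    _ ≤ K * ρ ^ n * (1 - ρ)⁻¹ := by gcongr
    _ = _ := by ring

end Cylinder

section CylinderMeasure

lemma measurableSet_cylinder_word {A : Type*} [MeasurableSpace A] [DiscreteMeasurableSpace A]
    (a : List A) : MeasurableSet (cylinder a) := by
  have : cylinder a = ⋂ i : Fin a.length, (fun ω : ℕ → A => ω i) ⁻¹' {a.get i} := by
    ext ω
    simp [_root_.cylinder]
  rw [this]
  exact MeasurableSet.iInter fun i => measurable_pi_apply _ (MeasurableSet.of_discrete)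

lemma measurable_shiftN {A : Type*} [MeasurableSpace A] :
    Measurable (shiftN : (ℕ → A) → ℕ → A) :=
  measurable_pi_lambda _ fun k => measurable_pi_apply (k + 1)

lemma measure_cylinder_eq_zero {A : Type*} [MeasurableSpace A] [DiscreteMeasurableSpace A]
    {μ : Measure (ℕ → A)} [IsProbabilityMeasure μ]
    {Y : Set (ℕ → A)} (hY : μ Y = 1) {x : List A} (hx : ¬ (cylinder x ∩ Y).Nonempty) :
    μ (cylinder x) = 0 := by
  rw [← compl_compl (cylinder x), prob_compl_eq_zero_iff (measurableSet_cylinder_word x).compl]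
  refine le_antisymm prob_le_one (hY ▸ measure_mono fun ω hω hx' => hx ⟨ω, hx', hω⟩)

variable {A : Type*} [Fintype A] [MeasurableSpace A] [DiscreteMeasurableSpace A]

lemma sum_measure_cylinder_append_singleton (μ : Measure (ℕ → A)) [IsFiniteMeasure μ]
    (w : List A) : ∑ a, (μ (cylinder (w ++ [a]))).toReal = (μ (cylinder w)).toReal := by
  rw [← iUnion_cylinder_append_singleton w, measure_iUnion ?_ fun a => measurableSet_cylinder_word _,
    tsum_fintype, ENNReal.toReal_sum fun a _ => measure_ne_top _ _]
  refine fun a b hab => Set.disjoint_left.2 fun ω ha hb => hab ?_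
  simp only [mem_cylinder_append, mem_cylinder_singleton] at ha hb
  exact ha.2.symm.trans hb.2

lemma sum_measure_cylinder_cons (μ : Measure (ℕ → A)) [IsFiniteMeasure μ]
    (hinv : μ.map shiftN = μ) (v : List A) :
    ∑ a, (μ (cylinder (a :: v))).toReal = (μ (cylinder v)).toReal := by
  conv_rhs => rw [← hinv, Measure.map_apply measurable_shiftN (measurableSet_cylinder_word v)]
  rw [← iUnion_cylinder_cons v, measure_iUnion ?_ fun a => measurableSet_cylinder_word _,
    tsum_fintype, ENNReal.toReal_sum fun a _ => measure_ne_top _ _]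
  refine fun a b hab => Set.disjoint_left.2 fun ω ha hb => hab ?_
  simp only [mem_cylinder_cons] at ha hb
  exact ha.1.symm.trans hb.1

end CylinderMeasure

section CylinderWeight

variable {A : Type*}

/-- The weight `sup_{[x] ∩ Y} exp (S_{|x|}φ - |x| P)` of a word `x`, zero if `[x] ∩ Y` is empty. -/
noncomputable def cylinderWeight (Y : Set (ℕ → A)) (φ : (ℕ → A) → ℝ) (P : ℝ) (x : List A) : ℝ :=
  sSup ((fun ω => Real.exp (-(x.length : ℝ) * P + birkhoff φ x.length ω)) '' (cylinder x ∩ Y))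

variable {Y : Set (ℕ → A)} {φ : (ℕ → A) → ℝ} {P : ℝ}

lemma cylinderWeight_nonneg (x : List A) : 0 ≤ cylinderWeight Y φ P x :=
  Real.sSup_nonneg (by rintro _ ⟨ω, -, rfl⟩; positivity)

lemma cylinderWeight_le {x : List A} {B : ℝ} (hB : 0 ≤ B)
    (h : ∀ ω ∈ cylinder x ∩ Y, Real.exp (-(x.length : ℝ) * P + birkhoff φ x.length ω) ≤ B) :
    cylinderWeight Y φ P x ≤ B :=
  Real.sSup_le (by rintro _ ⟨ω, hω, rfl⟩; exact h ω hω) hB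

lemma le_cylinderWeight {x : List A} {B : ℝ}
    (h : ∀ ω ∈ cylinder x ∩ Y, Real.exp (-(x.length : ℝ) * P + birkhoff φ x.length ω) ≤ B)
    {ω : ℕ → A} (hω : ω ∈ cylinder x ∩ Y) :
    Real.exp (-(x.length : ℝ) * P + birkhoff φ x.length ω) ≤ cylinderWeight Y φ P x :=
  le_csSup ⟨B, by rintro _ ⟨ω, hω, rfl⟩; exact h ω hω⟩ ⟨ω, hω, rfl⟩

/-- Prolonging on the left by `w` scales all weights of words starting with `v` by almost the same
factor. -/
lemma cylinderWeight_append_comparable {M : A → A → Prop} {ρ K : ℝ} (hρ0 : 0 ≤ ρ)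
    (hρ1 : ρ < 1) (hK : 0 ≤ K)
    (hφ : ∀ ω ∈ SFT M, ∀ ω' ∈ SFT M, ∀ N : ℕ, (∀ i < N, ω i = ω' i) → |φ ω - φ ω'| ≤ K * ρ ^ N)
    {B : List A → ℝ} (hB : ∀ x : List A, ∀ ω ∈ cylinder x ∩ SFT M,
      Real.exp (-(x.length : ℝ) * P + birkhoff φ x.length ω) ≤ B x)
    {w v : List A} (hv : v ≠ []) (hwv : (cylinder (w ++ v) ∩ SFT M).Nonempty) :
    ∃ Q > 0, ∀ y,
      cylinderWeight (SFT M) φ P (w ++ v ++ y) ≤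
        Real.exp (K / (1 - ρ) * ρ ^ v.length) * Q * cylinderWeight (SFT M) φ P (v ++ y) ∧
      Q * cylinderWeight (SFT M) φ P (v ++ y) ≤
        Real.exp (K / (1 - ρ) * ρ ^ v.length) * cylinderWeight (SFT M) φ P (w ++ v ++ y) := by
  obtain ⟨ω₀, h₀⟩ := hwv
  set δ := K / (1 - ρ) * ρ ^ v.length with hδ
  have hdist : ∀ ω ∈ cylinder (w ++ v) ∩ SFT M,
      |birkhoff φ w.length ω - birkhoff φ w.length ω₀| ≤ δ := fun ω hω =>
    abs_birkhoff_sub_le hρ0 hρ1 hK hφ _ _ hω.2 h₀.2 fun i hi =>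
      eq_of_mem_cylinder hω.1 h₀.1 (by simpa using hi)
  have hsplit : ∀ (ω : ℕ → A) (y : List A),
      Real.exp (-((w ++ v ++ y).length : ℝ) * P + birkhoff φ (w ++ v ++ y).length ω) =
      Real.exp (-(w.length : ℝ) * P + birkhoff φ w.length ω) *
      Real.exp (-((v ++ y).length : ℝ) * P +
        birkhoff φ (v ++ y).length (shiftN^[w.length] ω)) := fun ω y => by
    rw [← Real.exp_add, List.append_assoc, List.length_append (as := w), birkhoff_add]
    push_cast
    ring_nf
  refine ⟨Real.exp (-(w.length : ℝ) * P + birkhoff φ w.length ω₀), Real.exp_pos _,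
    fun y => ⟨?_, ?_⟩⟩
  · refine cylinderWeight_le (mul_nonneg (by positivity) (cylinderWeight_nonneg _))
      fun ω hω => ?_
    have hω' : shiftN^[w.length] ω ∈ cylinder (v ++ y) ∩ SFT M := by
      refine ⟨?_, shiftN_iterate_mem_SFT hω.2 _⟩
      have := hω.1
      rw [List.append_assoc, mem_cylinder_append] at this
      exact this.2
    rw [hsplit, ← Real.exp_add δ]
    refine mul_le_mul (Real.exp_le_exp.2 ?_) (le_cylinderWeight (hB _) hω') (by positivity)
      (by positivity)
    linarith [(abs_le.1 (hdist ω ⟨cylinder_append_subset _ _ hω.1, hω.2⟩)).2]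
  · rw [← le_div_iff₀' (Real.exp_pos _)]
    refine cylinderWeight_le (div_nonneg (mul_nonneg (by positivity) (cylinderWeight_nonneg _))
      (by positivity)) fun ω hω => ?_
    rw [le_div_iff₀' (Real.exp_pos _)]
    have hp : prepend w ω ∈ cylinder (w ++ v ++ y) ∩ SFT M := by
      refine ⟨?_, prepend_mem_SFT hv h₀ ⟨cylinder_append_subset _ _ hω.1, hω.2⟩⟩
      rw [List.append_assoc, mem_cylinder_append, shiftN_iterate_prepend]
      exact ⟨prepend_mem_cylinder _ _, hω.1⟩
    have h1 := le_cylinderWeight (hB _) hp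
    rw [hsplit, shiftN_iterate_prepend] at h1
    refine le_trans ?_ (mul_le_mul_of_nonneg_left h1 (Real.exp_pos δ).le)
    rw [← mul_assoc, ← Real.exp_add δ]
    refine mul_le_mul_of_nonneg_right (Real.exp_le_exp.2 ?_) (Real.exp_pos _).le
    linarith [(abs_le.1 (hdist _ ⟨cylinder_append_subset _ _ hp.1, hp.2⟩)).1]

end CylinderWeight

section Comparison

lemma div_le_mul_div_of_mul_le {a b c d E : ℝ} (hb : 0 < b) (hd : 0 < d)
    (h : a * d ≤ E * (b * c)) : a / b ≤ E * (c / d) := by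
  rw [← mul_div_assoc, div_le_div_iff₀ hb hd]
  linarith

lemma abs_sub_le_of_le_exp_mul {r s x : ℝ} (hr1 : r ≤ 1) (hs1 : s ≤ 1)
    (hx : 0 ≤ x) (hrs : r ≤ Real.exp x * s) (hsr : s ≤ Real.exp x * r) :
    |r - s| ≤ x * Real.exp x := by
  have h1 : Real.exp x - 1 ≤ x * Real.exp x := by
    have h2 := mul_le_mul_of_nonneg_right (Real.one_sub_le_exp_neg x) (Real.exp_pos x).le
    rw [← Real.exp_add, neg_add_cancel, Real.exp_zero] at h2
    linarith
  have h3 : 0 ≤ Real.exp x - 1 := sub_nonneg.2 (Real.one_le_exp hx)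
  rw [abs_le]
  constructor <;> nlinarith

end Comparison

theorem stmt9 {A : Type*} [Fintype A] [MeasurableSpace A] [DiscreteMeasurableSpace A]
    (M : A → A → Prop) (Y : Set (ℕ → A)) (hY : Y = SFT M)
    (htrans : IrreducibleTransition M)
    (ρ : ℝ) (hρ : ρ ∈ Set.Ioo (0 : ℝ) 1)
    (φ : (ℕ → A) → ℝ) (hHolder : IsHolder Y φ ρ)
    (μ : Measure (ℕ → A)) [IsProbabilityMeasure μ]
    (hinv : μ.map shiftN = μ) (hsupp : μ Y = 1)
    (P : ℝ) (hGibbs : HasGibbsProperty Y μ φ P) :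
    ∃ K > 0, ∀ u v c : List A,
      (cylinder (u ++ v ++ c) ∩ Y).Nonempty →
      |(μ (cylinder (u ++ v ++ c))).toReal / (μ (cylinder (u ++ v))).toReal -
          (μ (cylinder (v ++ c))).toReal / (μ (cylinder v)).toReal| ≤
        K * ρ ^ v.length := by
  subst hY
  obtain ⟨Kh, hKh, hφ⟩ := hHolder
  obtain ⟨Kg, hKg, hGibbs⟩ := hGibbs
  obtain ⟨hρ0, hρ1⟩ := hρ
  set F : List A → ℝ := fun x => (μ (cylinder x)).toReal with hFdef
  have hF : extensionSum A F = F := funext fun w => sum_measure_cylinder_append_singleton μ w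
  have hinvF : ∀ v, ∑ a, F (a :: v) = F v := sum_measure_cylinder_cons μ hinv
  have hF0 : ∀ x, 0 ≤ F x := fun x => ENNReal.toReal_nonneg
  have hFmono : ∀ p q, F (p ++ q) ≤ F p := fun p q =>
    ENNReal.toReal_mono (measure_ne_top _ _) (measure_mono (cylinder_append_subset p q))
  have hFzero : ∀ x : List A, ¬ (cylinder x ∩ SFT M).Nonempty → F x = 0 := fun x hx => by
    simp [hFdef, measure_cylinder_eq_zero hsupp hx]
  have hG : ∀ x : List A, ∀ ω ∈ cylinder x ∩ SFT M,
      Real.exp (-(x.length : ℝ) * P + birkhoff φ x.length ω) ≤ Kg * F x ∧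
      F x ≤ Kg * Real.exp (-(x.length : ℝ) * P + birkhoff φ x.length ω) := fun x ω hω => by
    have h := hGibbs x (shiftN^[x.length] ω) (by rw [prepend_shiftN_iterate hω.1]; exact hω.2)
    rwa [prepend_shiftN_iterate hω.1, inv_mul_le_iff₀ hKg] at h
  have hB : ∀ x : List A, ∀ ω ∈ cylinder x ∩ SFT M,
      Real.exp (-(x.length : ℝ) * P + birkhoff φ x.length ω) ≤ Kg * F x :=
    fun x ω hω => (hG x ω hω).1
  have hFpos : ∀ x : List A, (cylinder x ∩ SFT M).Nonempty → 0 < F x := fun x ⟨ω, hω⟩ =>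
    pos_of_mul_pos_right ((Real.exp_pos _).trans_le (hB x ω hω)) hKg.le
  obtain ⟨G, hGadd, hG0, hGF, hFG, hGineq⟩ := exists_additive_of_comparable
    (Z := cylinderWeight (SFT M) φ P) (K := Kg) hF cylinderWeight_nonneg
    (fun x => cylinderWeight_le (mul_nonneg hKg.le (hF0 x)) (hB x)) (fun x => by
      by_cases hx : (cylinder x ∩ SFT M).Nonempty
      · obtain ⟨ω, hω⟩ := hx
        exact (hG x ω hω).2.trans
          (mul_le_mul_of_nonneg_left (le_cylinderWeight (hB x) hω) hKg.le)
      · rw [hFzero x hx]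
        exact mul_nonneg hKg.le (cylinderWeight_nonneg x))
  have hGzero : ∀ x, F x = 0 → G x = 0 := fun x hx => le_antisymm (by simpa [hx] using hGF x) (hG0 x)
  have hGpos : ∀ x, 0 < F x → 0 < G x := fun x hx =>
    pos_of_mul_pos_right (hx.trans_le (hFG x)) hKg.le
  set D := Kh / (1 - ρ) with hD
  have hD0 : 0 < D := div_pos hKh (by linarith)
  have hGquasi : ∀ w v c : List A, v ≠ [] →
      G (v ++ c) * G (w ++ v) ≤
        Real.exp (2 * (D * ρ ^ v.length)) * G v * G (w ++ (v ++ c)) ∧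
      G v * G (w ++ (v ++ c)) ≤
        Real.exp (2 * (D * ρ ^ v.length)) * G (v ++ c) * G (w ++ v) := by
    intro w v c hv
    rw [← List.append_assoc]
    by_cases hwv : (cylinder (w ++ v) ∩ SFT M).Nonempty
    · obtain ⟨Q, hQ, hcomp⟩ := cylinderWeight_append_comparable hρ0.le hρ1 hKh.le hφ hB hv hwv
      rw [← hD] at hcomp
      set η := Real.exp (D * ρ ^ v.length) with hη
      have hη0 : 0 < η := Real.exp_pos _
      have hη2 : Real.exp (2 * (D * ρ ^ v.length)) = η * η := by
        rw [hη, ← Real.exp_add, two_mul]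
      have hup : ∀ z, G (w ++ v ++ z) ≤ η * Q * G (v ++ z) := fun z => by
        simpa using hGineq (w ++ v ++ z) (v ++ z) 1 (η * Q) fun y => by
          simpa using (hcomp (z ++ y)).1
      have hlo : ∀ z, Q * G (v ++ z) ≤ η * G (w ++ v ++ z) := fun z =>
        hGineq (v ++ z) (w ++ v ++ z) Q η fun y => by
          simpa using (hcomp (z ++ y)).2
      have hup0 : G (w ++ v) ≤ η * Q * G v := by simpa using hup []
      have hlo0 : Q * G v ≤ η * G (w ++ v) := by simpa using hlo []
      rw [hη2]
      constructor
      · calc G (v ++ c) * G (w ++ v) ≤ G (v ++ c) * (η * Q * G v) :=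
              mul_le_mul_of_nonneg_left hup0 (hG0 _)
          _ = η * G v * (Q * G (v ++ c)) := by ring
          _ ≤ η * G v * (η * G (w ++ v ++ c)) :=
              mul_le_mul_of_nonneg_left (hlo c) (mul_nonneg hη0.le (hG0 _))
          _ = _ := by ring
      · calc G v * G (w ++ v ++ c) ≤ G v * (η * Q * G (v ++ c)) :=
              mul_le_mul_of_nonneg_left (hup c) (hG0 _)
          _ = η * G (v ++ c) * (Q * G v) := by ring
          _ ≤ η * G (v ++ c) * (η * G (w ++ v)) :=
              mul_le_mul_of_nonneg_left hlo0 (mul_nonneg hη0.le (hG0 _))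
          _ = _ := by ring
    · have h1 := hFzero _ hwv
      have h2 : F (w ++ v ++ c) = 0 := le_antisymm (h1 ▸ hFmono _ _) (hF0 _)
      simp only [hGzero _ h1, hGzero _ h2, mul_zero, le_refl, and_self]
  have hFquasi : ∀ v c : List A, v ≠ [] →
      G (v ++ c) * F v ≤ Real.exp (2 * (D * ρ ^ v.length)) * G v * F (v ++ c) ∧
      G v * F (v ++ c) ≤ Real.exp (2 * (D * ρ ^ v.length)) * G (v ++ c) * F v := fun v c hv =>
    ⟨mul_le_mul_of_forall_left_extension hF hGadd hF0 hG0 hGF hFG hinvF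
      fun w => (hGquasi w v c hv).1,
    mul_le_mul_of_forall_left_extension hF hGadd hF0 hG0 hGF hFG hinvF
      fun w => (hGquasi w v c hv).2⟩
  refine ⟨6 * D * Real.exp (6 * D) + 1, by positivity, fun u v c huvc => ?_⟩
  change |F (u ++ v ++ c) / F (u ++ v) - F (v ++ c) / F v| ≤ _
  have hratio : ∀ p q, F (p ++ q) / F p ≤ 1 := fun p q => div_le_one_of_le₀ (hFmono p q) (hF0 p)
  have hratio0 : ∀ p q, 0 ≤ F (p ++ q) / F p := fun p q => div_nonneg (hF0 _) (hF0 _)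
  rcases eq_or_ne v [] with rfl | hv
  · refine (abs_le.2 ⟨?_, ?_⟩ : _ ≤ (1 : ℝ)).trans ?_
    · linarith [hratio [] c, hratio0 (u ++ []) c]
    · linarith [hratio0 [] c, hratio (u ++ []) c]
    · simp only [List.length_nil, pow_zero, mul_one]
      linarith [mul_pos (mul_pos (by norm_num : (0 : ℝ) < 6) hD0) (Real.exp_pos (6 * D))]
  set x := D * ρ ^ v.length with hx
  have hx0 : 0 ≤ x := by positivity
  have hxD : x ≤ D := mul_le_of_le_one_right hD0.le (pow_le_one₀ hρ0.le hρ1.le)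
  have hlen : Real.exp (2 * (D * ρ ^ (u ++ v).length)) ≤ Real.exp (2 * x) := by
    have : ρ ^ (u ++ v).length ≤ ρ ^ v.length :=
      pow_le_pow_of_le_one hρ0.le hρ1.le (by simp)
    rw [hx]
    gcongr
  have ha := hFpos _ huvc
  have hb : 0 < F (u ++ v) := ha.trans_le (hFmono _ _)
  have hFsuf : 0 < F (v ++ c) := by
    obtain ⟨ω, hω, hωY⟩ := huvc
    rw [List.append_assoc, mem_cylinder_append] at hω
    exact hFpos _ ⟨_, hω.2, shiftN_iterate_mem_SFT hωY _⟩
  have hFv : 0 < F v := hFsuf.trans_le (hFmono _ _)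
  have ha' := hGpos _ ha
  have hb' := hGpos _ hb
  have hs' := hGpos _ hFsuf
  have ht' := hGpos _ hFv
  have huv : u ++ v ≠ [] := by simp [hv]
  have h1 := hFquasi (u ++ v) c huv
  have h2 := hGquasi u v c hv
  have h3 := hFquasi v c hv
  rw [← hx] at h2 h3
  rw [← List.append_assoc] at h2
  have hexp : Real.exp (6 * x) = Real.exp (2 * x) * Real.exp (2 * x) * Real.exp (2 * x) := by
    rw [← Real.exp_add, ← Real.exp_add]
    ring_nf
  set E := Real.exp (2 * x) with hE
  have hE0 : 0 < E := Real.exp_pos _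
  have h1a : F (u ++ v ++ c) / F (u ++ v) ≤ E * (G (u ++ v ++ c) / G (u ++ v)) := by
    refine div_le_mul_div_of_mul_le hb hb' ?_
    linarith [h1.2, mul_le_mul_of_nonneg_right hlen (mul_pos ha' hb).le]
  have h1b : G (u ++ v ++ c) / G (u ++ v) ≤ E * (F (u ++ v ++ c) / F (u ++ v)) := by
    refine div_le_mul_div_of_mul_le hb' hb ?_
    linarith [h1.1, mul_le_mul_of_nonneg_right hlen (mul_pos hb' ha).le]
  have h2a : G (u ++ v ++ c) / G (u ++ v) ≤ E * (G (v ++ c) / G v) :=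
    div_le_mul_div_of_mul_le hb' ht' (by linarith [h2.2])
  have h2b : G (v ++ c) / G v ≤ E * (G (u ++ v ++ c) / G (u ++ v)) :=
    div_le_mul_div_of_mul_le ht' hb' (by linarith [h2.1])
  have h3a : G (v ++ c) / G v ≤ E * (F (v ++ c) / F v) :=
    div_le_mul_div_of_mul_le ht' hFv (by linarith [h3.1])
  have h3b : F (v ++ c) / F v ≤ E * (G (v ++ c) / G v) :=
    div_le_mul_div_of_mul_le hFv ht' (by linarith [h3.2])
  have hkey := abs_sub_le_of_le_exp_mul (x := 6 * x) (hratio (u ++ v) c) (hratio v c)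
    (by positivity)
    (by
      rw [hexp, mul_assoc, mul_assoc]
      exact h1a.trans (mul_le_mul_of_nonneg_left
        (h2a.trans (mul_le_mul_of_nonneg_left h3a hE0.le)) hE0.le))
    (by
      rw [hexp, mul_assoc, mul_assoc]
      exact h3b.trans (mul_le_mul_of_nonneg_left
        (h2b.trans (mul_le_mul_of_nonneg_left h1b hE0.le)) hE0.le))
  calc |F (u ++ v ++ c) / F (u ++ v) - F (v ++ c) / F v| ≤ 6 * x * Real.exp (6 * x) := hkey
    _ ≤ 6 * x * Real.exp (6 * D) := by gcongr
    _ = 6 * D * Real.exp (6 * D) * ρ ^ v.length := by rw [hx]; ring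
    _ ≤ (6 * D * Real.exp (6 * D) + 1) * ρ ^ v.length := by
      gcongr
      linarith
end

section
/- Let Λ and Λ' be finite alphabets, Ω = (Λ×Λ')^ℤ with the shift T, and μ a shift-invariant probability measure on Ω. Let α ∈ (0,1) be irrational, fix t ∈ [0,1), and fix finite words a over Λ and b over Λ'. For k ≥ 1 let 𝓗_{t,k} = 𝓕_{−l_k(t)+1}^{s_k(t)} ∨ 𝓖_{−l_k(t)+1}^0 and define (for any fixed versions of the conditional expectations) D_{t,k} = E[ (𝟙_{B̄} − E[𝟙_{B̄} | 𝓗_{t,k}]) · (𝟙_{Ā} ∘ T^{s_k(t)}) | 𝓗_{t,k} ]. Then D_{t,k} → 0 μ-almost surely as k → ∞. -/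
open MeasureTheory Filter Topology

/-- The two-sided shift on sequences. -/
def shiftZ {A : Type*} (ω : ℤ → A) : ℤ → A := fun k => ω (k + 1)

/-- `l_k(t) = ⌊t + α k⌋` (as a natural number). -/
noncomputable def lk (α t : ℝ) (k : ℕ) : ℕ := (⌊t + α * k⌋).toNat

/-- `s_k(t) = k - l_k(t)`. -/
noncomputable def sk (α t : ℝ) (k : ℕ) : ℕ := k - lk α t k

/-- The σ-algebra `𝓕_S` on `(Λ × Λ')^ℤ` generated by the first coordinates `ω¹_r`, `r ∈ S`. -/
def FalgZ {Λ Λ' : Type*} [MeasurableSpace Λ] (S : Set ℤ) :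
    MeasurableSpace (ℤ → Λ × Λ') :=
  ⨆ r ∈ S, MeasurableSpace.comap (fun ω : ℤ → Λ × Λ' => (ω r).1) inferInstance

/-- The σ-algebra `𝓖_S` on `(Λ × Λ')^ℤ` generated by the second coordinates `ω²_r`, `r ∈ S`. -/
def GalgZ {Λ Λ' : Type*} [MeasurableSpace Λ'] (S : Set ℤ) :
    MeasurableSpace (ℤ → Λ × Λ') :=
  ⨆ r ∈ S, MeasurableSpace.comap (fun ω : ℤ → Λ × Λ' => (ω r).2) inferInstance

/-- `Ā = {ω : ω¹_1 … ω¹_{|a|} = a}`. -/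
def AbarZ {Λ Λ' : Type*} (a : List Λ) : Set (ℤ → Λ × Λ') :=
  {ω | ∀ j : Fin a.length, (ω ((j : ℕ) + 1 : ℤ)).1 = a.get j}

/-- `B̄ = {ω : ω²_1 … ω²_{|b|} = b}`. -/
def BbarZ {Λ Λ' : Type*} (b : List Λ') : Set (ℤ → Λ × Λ') :=
  {ω | ∀ j : Fin b.length, (ω ((j : ℕ) + 1 : ℤ)).2 = b.get j}

/-- The σ-algebra `𝓗_{t,k} = 𝓕_{-l_k(t)+1}^{s_k(t)} ∨ 𝓖_{-l_k(t)+1}^0`. -/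
noncomputable def Htk {Λ Λ' : Type*} [MeasurableSpace Λ] [MeasurableSpace Λ']
    (α t : ℝ) (k : ℕ) : MeasurableSpace (ℤ → Λ × Λ') :=
  FalgZ (Set.Icc (-(lk α t k : ℤ) + 1) (sk α t k : ℤ)) ⊔
    GalgZ (Set.Icc (-(lk α t k : ℤ) + 1) 0)

section CondExp

variable {X : Type*} {m0 : MeasurableSpace X} {μ : Measure X} [IsProbabilityMeasure μ]

/-- Dominated convergence for conditional expectations along a filtration (Hunt's lemma), for
uniformly bounded functions that are measurable with respect to the limit σ-algebra. -/
theorem tendsto_ae_condExp_of_tendsto_zero (ℱ : Filtration ℕ m0) {Z : ℕ → X → ℝ} {C : ℝ}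
    (hZm : ∀ k, Measurable[⨆ n, ℱ n] (Z k))
    (hZC : ∀ k, ∀ᵐ x ∂μ, |Z k x| ≤ C)
    (hZ : ∀ᵐ x ∂μ, Tendsto (fun k => Z k x) atTop (𝓝 0)) :
    ∀ᵐ x ∂μ, Tendsto (fun k => (μ[Z k | ℱ k]) x) atTop (𝓝 0) := by
  have hle : (⨆ n, ℱ n) ≤ m0 := iSup_le ℱ.le
  let Y : ℕ → X → ℝ := fun m x => ⨆ k, |Z (m + k) x|
  have hYm : ∀ m, Measurable[⨆ n, ℱ n] (Y m) := fun m =>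
    Measurable.iSup fun k => continuous_abs.measurable.comp (hZm (m + k))
  have hall : ∀ᵐ x ∂μ, ∀ k, |Z k x| ≤ C := ae_all_iff.2 hZC
  have hYC : ∀ m, ∀ᵐ x ∂μ, ‖Y m x‖ ≤ C := fun m => by
    filter_upwards [hall] with x hx
    rw [Real.norm_of_nonneg (Real.iSup_nonneg fun k => abs_nonneg _)]
    exact ciSup_le fun k => hx _
  have hYi : ∀ m, Integrable (Y m) μ := fun m =>
    Integrable.of_bound ((hYm m).mono hle le_rfl).aestronglyMeasurable C (hYC m)
  have hZi : ∀ k, Integrable (Z k) μ := fun k =>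
    Integrable.of_bound ((hZm k).mono hle le_rfl).aestronglyMeasurable C (hZC k)
  have hYlim : ∀ᵐ x ∂μ, ∀ m, Tendsto (fun k => (μ[Y m | ℱ k]) x) atTop (𝓝 (Y m x)) :=
    ae_all_iff.2 fun m => (hYi m).tendsto_ae_condExp (hYm m).stronglyMeasurable
  have hZY : ∀ m k, m ≤ k → ∀ᵐ x ∂μ, |Z k x| ≤ Y m x := fun m k hmk => by
    filter_upwards [hall] with x hx
    obtain ⟨j, rfl⟩ := Nat.exists_eq_add_of_le hmk
    exact le_ciSup (f := fun k => |Z (m + k) x|) ⟨C, by rintro _ ⟨i, rfl⟩; exact hx _⟩ j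
  have hbd : ∀ᵐ x ∂μ, ∀ m k, m ≤ k → |(μ[Z k | ℱ k]) x| ≤ (μ[Y m | ℱ k]) x := by
    refine ae_all_iff.2 fun m => ae_all_iff.2 fun k => ?_
    by_cases hmk : m ≤ k
    · have h1 : μ[Z k | ℱ k] ≤ᵐ[μ] μ[Y m | ℱ k] := condExp_mono (hZi k) (hYi m) <| by
        filter_upwards [hZY m k hmk] with x hx using (le_abs_self _).trans hx
      have h2 : μ[-Z k | ℱ k] ≤ᵐ[μ] μ[Y m | ℱ k] := condExp_mono (hZi k).neg (hYi m) <| by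
        filter_upwards [hZY m k hmk] with x hx using (neg_le_abs _).trans hx
      filter_upwards [h1, h2, condExp_neg (μ := μ) (Z k) (ℱ k)] with x h1 h2 h3 _
      rw [h3, Pi.neg_apply] at h2
      exact abs_le'.2 ⟨h1, h2⟩
    · exact ae_of_all _ fun x h => absurd h hmk
  filter_upwards [hZ, hYlim, hbd] with x hx hY hb
  rw [Metric.tendsto_atTop] at hx
  refine tendsto_zero_iff_abs_tendsto_zero _ |>.2 (tendsto_order.2 ⟨fun c hc => ?_, fun ε hε => ?_⟩)
  · exact Eventually.of_forall fun k => hc.trans_le (abs_nonneg _)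
  · obtain ⟨m, hm⟩ := hx (ε / 2) (half_pos hε)
    have hYm : Y m x < ε := by
      refine lt_of_le_of_lt (ciSup_le fun k => ?_) (half_lt_self hε)
      have := hm (m + k) (Nat.le_add_right _ _)
      rw [Real.dist_eq, sub_zero] at this
      exact this.le
    filter_upwards [(hY m).eventually_lt_const hYm, eventually_ge_atTop m] with k hk hmk
    exact (hb m k hmk).trans_lt hk

/-- If two filtrations `ℱ ≤ 𝒢` have the same limit σ-algebra, then the conditional covariances
given `ℱ k` of a bounded function `f` and bounded `𝒢 k`-measurable functions `g k` vanish
asymptotically. -/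
theorem tendsto_ae_condExp_sub_condExp_mul (ℱ 𝒢 : Filtration ℕ m0) (hℱ𝒢 : ∀ k, ℱ k ≤ 𝒢 k)
    (hsup : ∀ k, 𝒢 k ≤ ⨆ n, ℱ n) {f : X → ℝ} (hf : Measurable f) {C : ℝ}
    (hfC : ∀ x, |f x| ≤ C)
    {g : ℕ → X → ℝ} (hg : ∀ k, Measurable[𝒢 k] (g k)) (hg1 : ∀ k x, |g k x| ≤ 1) :
    ∀ᵐ x ∂μ, Tendsto (fun k => (μ[fun y => (f y - (μ[f | ℱ k]) y) * g k y | ℱ k]) x)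
      atTop (𝓝 0) := by
  have hfi : Integrable f μ := Integrable.of_bound hf.aestronglyMeasurable C (ae_of_all _ hfC)
  have hbd : ∀ m : MeasurableSpace X, ∀ᵐ x ∂μ, |(μ[f | m]) x| ≤ C := fun m =>
    ae_bdd_abs_condExp_of_ae_bdd_abs (ae_of_all _ hfC)
  let Z : ℕ → X → ℝ := fun k x => ((μ[f | 𝒢 k]) x - (μ[f | ℱ k]) x) * g k x
  have heq : (⨆ n, 𝒢 n) = ⨆ n, ℱ n :=
    le_antisymm (iSup_le hsup) (iSup_mono hℱ𝒢)
  have hmul : ∀ k (u : ℝ) x, |u * g k x| ≤ |u| := fun k u x => by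
    rw [abs_mul]
    exact mul_le_of_le_one_right (abs_nonneg _) (hg1 k x)
  have hZ : ∀ᵐ x ∂μ, Tendsto (fun k => (μ[Z k | ℱ k]) x) atTop (𝓝 0) := by
    refine tendsto_ae_condExp_of_tendsto_zero ℱ (C := C + C) (fun k => ?_) (fun k => ?_) ?_
    · exact (((stronglyMeasurable_condExp.measurable).mono (hsup k) le_rfl).sub
        ((stronglyMeasurable_condExp.measurable).mono (le_iSup (fun n => ℱ n) k) le_rfl)).mul
        ((hg k).mono (hsup k) le_rfl)
    · filter_upwards [hbd (ℱ k), hbd (𝒢 k)] with x h1 h2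
      exact (hmul k _ x).trans ((abs_sub _ _).trans (add_le_add h2 h1))
    · filter_upwards [tendsto_ae_condExp (μ := μ) (ℱ := ℱ) f,
        tendsto_ae_condExp (μ := μ) (ℱ := 𝒢) f] with x h1 h2
      rw [heq] at h2
      have h3 := (h2.sub h1).abs
      rw [sub_self, abs_zero] at h3
      exact squeeze_zero_norm (fun k => hmul k _ x) h3
  have hcond : ∀ k, μ[fun y => (f y - (μ[f | ℱ k]) y) * g k y | ℱ k] =ᵐ[μ] μ[Z k | ℱ k] := by
    intro k
    have hdi : Integrable (f - μ[f | ℱ k]) μ := hfi.sub integrable_condExp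
    have hgm : StronglyMeasurable[𝒢 k] (g k) := (hg k).stronglyMeasurable
    have hpi : Integrable ((f - μ[f | ℱ k]) * g k) μ :=
      hdi.mono (hdi.aestronglyMeasurable.mul (hgm.mono (𝒢.le k)).aestronglyMeasurable)
        (ae_of_all _ fun x => hmul k _ x)
    have h1 : μ[(f - μ[f | ℱ k]) * g k | 𝒢 k] =ᵐ[μ] Z k := by
      refine (condExp_mul_of_stronglyMeasurable_right hgm hpi hdi).trans ?_
      filter_upwards [condExp_sub (μ := μ) hfi integrable_condExp (𝒢 k)] with x hx
      rw [Pi.mul_apply, hx, Pi.sub_apply, condExp_of_stronglyMeasurable (𝒢.le k)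
        (stronglyMeasurable_condExp.mono (hℱ𝒢 k)) integrable_condExp]
    exact (condExp_condExp_of_le (hℱ𝒢 k) (𝒢.le k)).symm.trans (condExp_congr_ae h1)
  filter_upwards [hZ, ae_all_iff.2 hcond] with x hx hc
  simpa only [hc] using hx

end CondExp

section Slopes

variable {α t : ℝ}

theorem lk_mono (hα : 0 ≤ α) : Monotone (lk α t) := fun i j hij => by
  refine Int.toNat_le_toNat (Int.floor_le_floor ?_)
  gcongr

theorem sk_mono (hα : α ≤ 1) : Monotone (sk α t) := by
  refine monotone_nat_of_le_succ fun k => ?_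
  have h : ⌊t + α * (k + 1 : ℕ)⌋ ≤ ⌊t + α * k⌋ + 1 := by
    rw [← Int.floor_add_one]
    push_cast
    exact Int.floor_le_floor (by linarith)
  unfold sk lk
  omega

theorem exists_le_sk (hα : α < 1) (N : ℕ) : ∃ k, N ≤ sk α t k := by
  obtain ⟨k, hk⟩ := exists_nat_gt ((N + |t|) / (1 - α))
  rw [div_lt_iff₀ (by linarith)] at hk
  refine ⟨k + N, ?_⟩
  have h : ⌊t + α * (k + N : ℕ)⌋ ≤ (k : ℤ) := by
    refine Int.floor_le_iff.2 ?_
    push_cast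
    nlinarith [le_abs_self t, (Nat.cast_nonneg N : (0 : ℝ) ≤ N)]
  unfold sk lk
  omega

end Slopes

section Sequences

variable {Λ Λ' : Type*}

theorem measurable_fst_FalgZ [MeasurableSpace Λ] {S : Set ℤ} {r : ℤ} (hr : r ∈ S) :
    Measurable[FalgZ S] (fun ω : ℤ → Λ × Λ' => (ω r).1) :=
  Measurable.of_comap_le (le_iSup₂_of_le r hr le_rfl)

theorem FalgZ_le [MeasurableSpace Λ] [MeasurableSpace Λ'] (S : Set ℤ) :
    (FalgZ S : MeasurableSpace (ℤ → Λ × Λ')) ≤ MeasurableSpace.pi :=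
  iSup₂_le fun r _ => (measurable_fst.comp (measurable_pi_apply r)).comap_le

theorem GalgZ_le [MeasurableSpace Λ] [MeasurableSpace Λ'] (S : Set ℤ) :
    (GalgZ S : MeasurableSpace (ℤ → Λ × Λ')) ≤ MeasurableSpace.pi :=
  iSup₂_le fun r _ => (measurable_snd.comp (measurable_pi_apply r)).comap_le

theorem FalgZ_mono [MeasurableSpace Λ] {S S' : Set ℤ} (h : S ⊆ S') :
    (FalgZ S : MeasurableSpace (ℤ → Λ × Λ')) ≤ FalgZ S' :=
  biSup_mono h

theorem GalgZ_mono [MeasurableSpace Λ'] {S S' : Set ℤ} (h : S ⊆ S') :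
    (GalgZ S : MeasurableSpace (ℤ → Λ × Λ')) ≤ GalgZ S' :=
  biSup_mono h

theorem shiftZ_iterate_apply {A : Type*} (n : ℕ) (ω : ℤ → A) (r : ℤ) :
    shiftZ^[n] ω r = ω (r + n) := by
  induction n generalizing ω with
  | zero => simp
  | succ n ih =>
    rw [Function.iterate_succ_apply, ih, shiftZ]
    push_cast
    ring_nf

theorem measurableSet_BbarZ [MeasurableSpace Λ] [MeasurableSpace Λ'] [DiscreteMeasurableSpace Λ']
    (b : List Λ') :
    MeasurableSet (BbarZ b : Set (ℤ → Λ × Λ')) := by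
  rw [BbarZ, Set.ofPred_forall]
  exact MeasurableSet.iInter fun j =>
    (measurable_snd.comp (measurable_pi_apply _)) (MeasurableSet.of_discrete (s := {b.get j}))

theorem measurableSet_preimage_AbarZ [MeasurableSpace Λ] [DiscreteMeasurableSpace Λ]
    (a : List Λ) (n : ℕ) {S : Set ℤ}
    (hS : Set.Icc (n + 1 : ℤ) (n + a.length) ⊆ S) :
    MeasurableSet[FalgZ S] (shiftZ^[n] ⁻¹' (AbarZ a : Set (ℤ → Λ × Λ'))) := by
  rw [AbarZ, Set.ofPred_forall, Set.preimage_iInter]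
  refine MeasurableSet.iInter fun j => ?_
  simp only [Set.preimage_ofPred_eq, shiftZ_iterate_apply]
  refine measurable_fst_FalgZ (hS ?_) (MeasurableSet.of_discrete (s := {a.get j}))
  have := j.isLt
  constructor <;> omega

variable [MeasurableSpace Λ'] [MeasurableSpace Λ]

/-- The σ-algebra `Htk α t k`, with the window of first coordinates extended by `p` to the
right. -/
noncomputable abbrev extendedHtk (α t : ℝ) (p k : ℕ) : MeasurableSpace (ℤ → Λ × Λ') :=
  FalgZ (Set.Icc (-(lk α t k : ℤ) + 1) (sk α t k + p : ℤ)) ⊔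
    GalgZ (Set.Icc (-(lk α t k : ℤ) + 1) 0)

theorem extendedHtk_zero (α t : ℝ) (k : ℕ) :
    (extendedHtk α t 0 k : MeasurableSpace (ℤ → Λ × Λ')) = Htk α t k := by
  simp [extendedHtk, Htk]

theorem extendedHtk_le_extendedHtk {α t : ℝ} {p q i j : ℕ} (hl : lk α t i ≤ lk α t j)
    (hs : sk α t i + p ≤ sk α t j + q) :
    (extendedHtk α t p i : MeasurableSpace (ℤ → Λ × Λ')) ≤ extendedHtk α t q j :=
  sup_le_sup (FalgZ_mono (Set.Icc_subset_Icc (by omega) (by omega)))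
    (GalgZ_mono (Set.Icc_subset_Icc (by omega) le_rfl))

/-- The filtration `k ↦ extendedHtk α t p k`. -/
noncomputable def extendedHtkFiltration {α : ℝ} (hα0 : 0 ≤ α) (hα1 : α ≤ 1) (t : ℝ) (p : ℕ) :
    Filtration ℕ (MeasurableSpace.pi : MeasurableSpace (ℤ → Λ × Λ')) where
  seq := extendedHtk α t p
  mono' _ _ hij := extendedHtk_le_extendedHtk (lk_mono hα0 hij)
    (Nat.add_le_add_right (sk_mono hα1 hij) p)
  le' _ := sup_le (FalgZ_le _) (GalgZ_le _)

end Sequences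

theorem stmt12 {Λ Λ' : Type*} [Fintype Λ] [Fintype Λ']
    [MeasurableSpace Λ] [DiscreteMeasurableSpace Λ]
    [MeasurableSpace Λ'] [DiscreteMeasurableSpace Λ']
    (μ : Measure (ℤ → Λ × Λ')) [IsProbabilityMeasure μ]
    (hinv : μ.map shiftZ = μ)
    (α : ℝ) (hα : Irrational α) (hα01 : α ∈ Set.Ioo (0 : ℝ) 1)
    (t : ℝ) (ht : t ∈ Set.Ico (0 : ℝ) 1)
    (a : List Λ) (b : List Λ') :
    ∀ᵐ ω ∂μ,
      Tendsto (fun k : ℕ =>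
          (μ[fun ω' => (Set.indicator (BbarZ b) (1 : (ℤ → Λ × Λ') → ℝ) ω' -
                (μ[Set.indicator (BbarZ b) (1 : (ℤ → Λ × Λ') → ℝ) | Htk α t k]) ω') *
              Set.indicator (AbarZ a) (1 : (ℤ → Λ × Λ') → ℝ) (shiftZ^[sk α t k] ω') |
            Htk α t k]) ω)
        atTop (𝓝 0) := by
  have h0 := hα01.1.le
  have h1 := hα01.2.le
  let ℱ := extendedHtkFiltration (Λ := Λ) (Λ' := Λ') h0 h1 t 0
  let 𝒢 := extendedHtkFiltration (Λ := Λ) (Λ' := Λ') h0 h1 t a.length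
  have habs : ∀ (s : Set (ℤ → Λ × Λ')) x, |s.indicator (1 : (ℤ → Λ × Λ') → ℝ) x| ≤ 1 :=
    fun s x => by
      by_cases hx : x ∈ s <;> simp [hx]
  have key := tendsto_ae_condExp_sub_condExp_mul (μ := μ) ℱ 𝒢
    (fun k => extendedHtk_le_extendedHtk le_rfl (by omega)) (fun k => ?_)
    (f := (BbarZ b).indicator 1) (measurable_one.indicator (measurableSet_BbarZ b))
    (C := 1) (habs _)
    (g := fun k ω => (AbarZ a).indicator 1 (shiftZ^[sk α t k] ω)) (fun k => ?_)
    (fun k x => habs _ _)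
  · have hℱ : ∀ k, ℱ k = Htk α t k := extendedHtk_zero α t
    simpa only [hℱ] using key
  · obtain ⟨j, hj⟩ := exists_le_sk (t := t) hα01.2 (sk α t k + a.length)
    exact (extendedHtk_le_extendedHtk (lk_mono h0 (le_max_left k j))
      (hj.trans (sk_mono h1 (le_max_right k j)))).trans (le_iSup (fun n => ℱ n) (max k j))
  · have hA : MeasurableSet[𝒢 k] (shiftZ^[sk α t k] ⁻¹' (AbarZ a : Set (ℤ → Λ × Λ'))) :=
      le_sup_left (α := MeasurableSpace (ℤ → Λ × Λ')) _
        (measurableSet_preimage_AbarZ a _ (Set.Icc_subset_Icc (by omega) le_rfl))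
    exact Measurable.indicator measurable_const hA
end
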